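/- arXiv:1412.8236 — 4 statements merged into one kernel-verified Lean document; each statement's English description precedes it below -/
import Mathlib

section
/- Let X ∈ ℝ^{N×N} be symmetric positive semidefinite and let k be an integer with 0 ≤ k ≤ N. Then the minimum of Tr(Yᵀ X) over all symmetric Y ∈ ℝ^{N×N} satisfying 0 ⪯ Y ⪯ I_N and Tr(Y) = k equals zero if and only if rank(X) ≤ N − k. -/
open Matrix

/-- For a symmetric positive semidefinite `X`, the minimum of `Tr(Yᵀ X)` over all
symmetric `Y` with `0 ⪯ Y ⪯ I` and `Tr(Y) = k` equals zero iff `rank(X) ≤ N − k`. -/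
theorem min_trace_eq_zero_iff_rank_le
    (N k : ℕ) (hk : k ≤ N)
    (X : Matrix (Fin N) (Fin N) ℝ) (hX : X.PosSemidef) :
    IsLeast
      {t : ℝ | ∃ Y : Matrix (Fin N) (Fin N) ℝ,
        Y.IsHermitian ∧ Y.PosSemidef ∧
        ((1 : Matrix (Fin N) (Fin N) ℝ) - Y).PosSemidef ∧
        Y.trace = (k : ℝ) ∧ t = (Yᵀ * X).trace}
      0
      ↔ X.rank ≤ N - k := by
  classical
  obtain ⟨U, l, h1, h2, hXU, hl, hr⟩ : ∃ (U : Matrix (Fin N) (Fin N) ℝ) (l : Fin N → ℝ),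
      Uᴴ * U = 1 ∧ U * Uᴴ = 1 ∧ X = U * diagonal l * Uᴴ ∧ (∀ i, 0 ≤ l i) ∧
      X.rank = (Finset.univ.filter (fun i => l i ≠ 0)).card := by
    refine ⟨hX.1.eigenvectorUnitary, hX.1.eigenvalues, ?_, ?_, ?_, hX.eigenvalues_nonneg, ?_⟩
    · exact Unitary.coe_star_mul_self hX.1.eigenvectorUnitary
    · exact Unitary.coe_mul_star_self hX.1.eigenvectorUnitary
    · have := hX.1.spectral_theorem
      rw [Unitary.conjStarAlgAut_apply] at this
      exact this
    · rw [hX.1.rank_eq_card_non_zero_eigs, Fintype.card_subtype]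
  have hcard : (Finset.univ.filter (fun i => l i = 0)).card
      + (Finset.univ.filter (fun i => l i ≠ 0)).card = N := by
    have := Finset.card_filter_add_card_filter_not (s := (Finset.univ : Finset (Fin N)))
      (fun i => l i = 0)
    simpa using this
  have key : ∀ Y : Matrix (Fin N) (Fin N) ℝ, Y.IsHermitian →
      (Yᵀ * X).trace = ∑ i, (Uᴴ * Y * U) i i * l i := by
    intro Y hY
    have hYt : Yᵀ = Y := by
      have := hY.eq
      rwa [conjTranspose_eq_transpose_of_trivial] at this
    rw [hYt, hXU]
    have : (Y * (U * diagonal l * Uᴴ)).trace = ((Uᴴ * Y * U) * diagonal l).trace := by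
      rw [← Matrix.mul_assoc, Matrix.trace_mul_comm]
      simp only [Matrix.mul_assoc]
    rw [this]
    simp [Matrix.trace, Matrix.mul_diagonal]
  have hnn : ∀ Y : Matrix (Fin N) (Fin N) ℝ, Y.PosSemidef → ∀ i, 0 ≤ (Uᴴ * Y * U) i i :=
    fun Y hY i => (hY.conjTranspose_mul_mul_same U).diag_nonneg
  have htr : ∀ Y : Matrix (Fin N) (Fin N) ℝ, ∑ i, (Uᴴ * Y * U) i i = Y.trace := by
    intro Y
    change (Uᴴ * Y * U).trace = _
    rw [Matrix.trace_mul_comm, ← Matrix.mul_assoc, h2, Matrix.one_mul]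
  constructor
  · rintro ⟨⟨Y, hH, hY, hY1, hk', h0⟩, -⟩
    rw [key Y hH] at h0
    have hz := (Finset.sum_eq_zero_iff_of_nonneg
      (fun i _ => mul_nonneg (hnn Y hY i) (hl i))).1 h0.symm
    have hle : ∀ i, (Uᴴ * Y * U) i i ≤ 1 := by
      intro i
      have := hnn _ hY1 i
      rw [Matrix.mul_sub, Matrix.sub_mul, Matrix.mul_one, h1] at this
      simpa using this
    have : (k : ℝ) ≤ ((Finset.univ.filter (fun i => l i = 0)).card : ℝ) := by
      rw [← hk', ← htr, Finset.card_filter]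
      push_cast
      refine Finset.sum_le_sum fun i hi => ?_
      split_ifs with h
      · exact hle i
      · have := hz i hi
        simp only [mul_eq_zero, h, or_false] at this
        exact this.le
    have : k ≤ (Finset.univ.filter (fun i => l i = 0)).card := by exact_mod_cast this
    omega
  · intro h
    refine ⟨?_, ?_⟩
    · have : k ≤ (Finset.univ.filter (fun i => l i = 0)).card := by omega
      obtain ⟨S, hS, hSk⟩ := Finset.exists_subset_card_eq this
      let d : Fin N → ℝ := fun i => if i ∈ S then 1 else 0
      have hd0 : (diagonal d).PosSemidef := by
        refine PosSemidef.diagonal fun i => ?_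
        simp only [d, Pi.zero_apply]
        split_ifs <;> norm_num
      have hd1 : (1 - diagonal d).PosSemidef := by
        rw [← diagonal_one, diagonal_sub]
        refine PosSemidef.diagonal fun i => ?_
        simp only [d, Pi.zero_apply]
        split_ifs <;> norm_num
      have hP := hd0.mul_mul_conjTranspose_same U
      have hU : Uᴴ * (U * diagonal d * Uᴴ) * U = diagonal d := by
        have : Uᴴ * (U * diagonal d * Uᴴ) * U = (Uᴴ * U) * diagonal d * (Uᴴ * U) := by
          simp only [Matrix.mul_assoc]
        rw [this, h1, Matrix.one_mul, Matrix.mul_one]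
      refine ⟨U * diagonal d * Uᴴ, hP.1, hP, ?_, ?_, ?_⟩
      · have := hd1.mul_mul_conjTranspose_same U
        rwa [Matrix.mul_sub, Matrix.sub_mul, Matrix.mul_one, h2] at this
      · rw [← htr, hU]
        simp [d, hSk]
      · rw [key _ hP.1, hU]
        symm
        refine Finset.sum_eq_zero fun i _ => ?_
        rw [diagonal_apply_eq]
        by_cases hi : i ∈ S
        · have := hS hi
          simp only [Finset.mem_filter] at this
          rw [this.2, mul_zero]
        · simp [d, hi]
    · rintro t ⟨Y, hH, hY, -, -, rfl⟩
      rw [key Y hH]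
      exact Finset.sum_nonneg fun i _ => mul_nonneg (hnn Y hY i) (hl i)
end

section
/- Let X₁₁ ∈ ℝ^{n×n} be symmetric positive definite, γ > 0, u ≥ 0, M ∈ ℝ^{m×n}, and V ∈ ℝ^{m×m} symmetric. If the symmetric block matrix [[V, M],[Mᵀ, γ X₁₁⁻¹]] is positive semidefinite and V_{ii} ≤ u² for every i ∈ {1,…,m}, then for every x ∈ ℝⁿ with xᵀ (γ X₁₁⁻¹) x ≤ 1 one has |(Mx)_i| ≤ u for every i, i.e. ‖Mx‖_∞ ≤ u. (This is the linear matrix inequality used to enforce the componentwise bound ‖u(t)‖_∞ ≤ u_max on the control input u = KCx over the invariant ellipsoid {x : xᵀ X₁₁⁻¹ x ≤ γ⁻¹}.) -/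
open Matrix

/-- **Componentwise input-norm LMI.** If `[[V, M],[Mᵀ, γ X₁₁⁻¹]] ⪰ 0` and `V_{ii} ≤ u²`
for all `i`, then `‖Mx‖_∞ ≤ u` for every `x` in the ellipsoid
`{x : xᵀ (γ X₁₁⁻¹) x ≤ 1}`. -/
theorem inf_norm_bound_of_lmi
    (n m : ℕ) (hn : 0 < n) (hm : 0 < m)
    (X11 : Matrix (Fin n) (Fin n) ℝ) (hX11 : X11.PosDef)
    (γ : ℝ) (hγ : 0 < γ) (u : ℝ) (hu : 0 ≤ u)
    (M : Matrix (Fin m) (Fin n) ℝ)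
    (V : Matrix (Fin m) (Fin m) ℝ) (hV : V.IsHermitian)
    (hLMI : (Matrix.fromBlocks V M Mᵀ (γ • X11⁻¹)).PosSemidef)
    (hVdiag : ∀ i : Fin m, V i i ≤ u ^ 2) :
    ∀ x : Fin n → ℝ, x ⬝ᵥ (γ • X11⁻¹).mulVec x ≤ 1 →
      ∀ i : Fin m, |M.mulVec x i| ≤ u := by
  intro x hx i
  set y := M.mulVec x i with hy
  have h := hLMI.dotProduct_mulVec_nonneg (Sum.elim (Pi.single i 1) ((-y) • x))
  have h1 : (Mᵀ *ᵥ Pi.single i 1) = M i := by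
    ext j; simp
  have h2 : x ⬝ᵥ M i = y := by
    rw [hy, dotProduct_comm]; rfl
  rw [star_trivial, Matrix.fromBlocks_mulVec, sumElim_dotProduct_sumElim] at h
  simp only [Sum.elim_comp_inl, Sum.elim_comp_inr, h1, dotProduct_add, mulVec_smul,
    smul_dotProduct, dotProduct_smul, h2, single_dotProduct, smul_eq_mul, one_mul] at h
  have h3 : (V *ᵥ Pi.single i 1) i = V i i := by simp
  rw [h3, ← hy] at h
  have h4 := hVdiag i
  refine abs_le_of_sq_le_sq ?_ hu
  nlinarith [mul_nonneg (sq_nonneg y) (sub_nonneg.mpr hx)]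
end

section
/- Let p, q, a, b, n be positive integers with n < min(p, q), let W₁ ∈ ℝ^{a×p} and W₂ ∈ ℝ^{q×b}, and let F ⊆ ℝ^{p×q} be an arbitrary set of matrices (encoding arbitrary equality and inequality constraints). For Y ∈ ℝ^{p×q}, let Y₁₁ denote its top-left n×n submatrix, and let F' = {Y ∈ F : rank(Y₁₁) = n}. Let ν be a real number with ν > a·b, and suppose there exists Y ∈ F' with rank(Y) = n. Then a matrix Y* satisfies: Y* ∈ F', rank(Y*) = n, and ‖W₁ Y* W₂‖₀ ≤ ‖W₁ Y W₂‖₀ for all Y ∈ F' with rank(Y) = n, if and only if Y* ∈ F' and ‖W₁ Y* W₂‖₀ + ν·rank(Y*) ≤ ‖W₁ Y W₂‖₀ + ν·rank(Y) for all Y ∈ F'. -/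
open Matrix

/-- The `ℓ₀`-norm of a matrix: the number of its nonzero entries. -/
noncomputable def l0norm {a b : ℕ} (M : Matrix (Fin a) (Fin b) ℝ) : ℕ :=
  {p : Fin a × Fin b | M p.1 p.2 ≠ 0}.ncard

/-- The top-left `n × n` submatrix of a `p × q` matrix (`n ≤ p`, `n ≤ q`). -/
def topLeft {p q n : ℕ} (hp : n ≤ p) (hq : n ≤ q) (Y : Matrix (Fin p) (Fin q) ℝ) :
    Matrix (Fin n) (Fin n) ℝ :=
  Y.submatrix (Fin.castLE hp) (Fin.castLE hq)

theorem l0norm_le_aux {a b : ℕ} (M : Matrix (Fin a) (Fin b) ℝ) : l0norm M ≤ a * b := by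
  unfold l0norm
  refine (Set.ncard_le_card _).trans ?_
  simp

theorem topLeft_rank_le_aux {p q n : ℕ} (hp : n ≤ p) (hq : n ≤ q)
    (Y : Matrix (Fin p) (Fin q) ℝ) : (topLeft hp hq Y).rank ≤ Y.rank := by
  unfold topLeft
  exact Matrix.rank_submatrix_le _ _ _

/-- **Lemma 2.** With `F' = {Y ∈ F : rank(Y₁₁) = n}` and `ν > a·b`, assuming `F'`
contains a matrix of rank `n`, a matrix `Y*` minimizes `‖W₁ Y W₂‖₀` over the rank-`n`
matrices of `F'` iff it minimizes `‖W₁ Y W₂‖₀ + ν·rank(Y)` over `F'`. -/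
theorem card_min_iff_card_rank_min
    (p q a b n : ℕ) (hp : 0 < p) (hq : 0 < q) (ha : 0 < a) (hb : 0 < b)
    (hn : 0 < n) (hnpq : n < min p q)
    (W1 : Matrix (Fin a) (Fin p) ℝ) (W2 : Matrix (Fin q) (Fin b) ℝ)
    (F : Set (Matrix (Fin p) (Fin q) ℝ))
    (ν : ℝ) (hν : (a : ℝ) * (b : ℝ) < ν)
    (hfeas : ∃ Y ∈ F,
      (topLeft (le_of_lt (lt_min_iff.mp hnpq).1) (le_of_lt (lt_min_iff.mp hnpq).2) Y).rank = n
        ∧ Y.rank = n)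
    (Ystar : Matrix (Fin p) (Fin q) ℝ) :
    (Ystar ∈ F ∧
      (topLeft (le_of_lt (lt_min_iff.mp hnpq).1) (le_of_lt (lt_min_iff.mp hnpq).2) Ystar).rank = n ∧
      Ystar.rank = n ∧
      ∀ Y ∈ F,
        (topLeft (le_of_lt (lt_min_iff.mp hnpq).1) (le_of_lt (lt_min_iff.mp hnpq).2) Y).rank = n →
        Y.rank = n →
        l0norm (W1 * Ystar * W2) ≤ l0norm (W1 * Y * W2))
    ↔
    (Ystar ∈ F ∧
      (topLeft (le_of_lt (lt_min_iff.mp hnpq).1) (le_of_lt (lt_min_iff.mp hnpq).2) Ystar).rank = n ∧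
      ∀ Y ∈ F,
        (topLeft (le_of_lt (lt_min_iff.mp hnpq).1) (le_of_lt (lt_min_iff.mp hnpq).2) Y).rank = n →
        (l0norm (W1 * Ystar * W2) : ℝ) + ν * (Ystar.rank : ℝ)
          ≤ (l0norm (W1 * Y * W2) : ℝ) + ν * (Y.rank : ℝ)) := by
  have hab : ∀ Y : Matrix (Fin p) (Fin q) ℝ, (l0norm (W1 * Y * W2) : ℝ) ≤ a * b := by
    intro Y
    exact_mod_cast l0norm_le_aux (W1 * Y * W2)
  have hν0 : 0 < ν := lt_of_le_of_lt (by positivity) hν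
  constructor
  · rintro ⟨h1, h2, h3, h4⟩
    refine ⟨h1, h2, fun Y hY hr => ?_⟩
    have hge : n ≤ Y.rank := hr.symm.le.trans (topLeft_rank_le_aux _ _ Y)
    rcases hge.eq_or_lt with he | hlt
    · have h5 : (l0norm (W1 * Ystar * W2) : ℝ) ≤ l0norm (W1 * Y * W2) := by
        exact_mod_cast h4 Y hY hr he.symm
      rw [h3, ← he]
      linarith
    · have h5 : (n : ℝ) + 1 ≤ Y.rank := by exact_mod_cast hlt
      have h6 := mul_le_mul_of_nonneg_left h5 hν0.le
      have h7 := hab Ystar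
      have h8 : (0 : ℝ) ≤ l0norm (W1 * Y * W2) := Nat.cast_nonneg _
      rw [h3]
      linarith
  · rintro ⟨h1, h2, h4⟩
    have hge : n ≤ Ystar.rank := h2.symm.le.trans (topLeft_rank_le_aux _ _ Ystar)
    have h3 : Ystar.rank = n := by
      rcases hge.eq_or_lt with he | hlt
      · exact he.symm
      · exfalso
        obtain ⟨Y, hY, hr, hYn⟩ := hfeas
        have h9 := h4 Y hY hr
        rw [hYn] at h9
        have h5 : (n : ℝ) + 1 ≤ Ystar.rank := by exact_mod_cast hlt
        have h6 := mul_le_mul_of_nonneg_left h5 hν0.le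
        have h7 := hab Y
        have h8 : (0 : ℝ) ≤ l0norm (W1 * Ystar * W2) := Nat.cast_nonneg _
        linarith
    refine ⟨h1, h2, h3, fun Y hY hr hYn => ?_⟩
    have h9 := h4 Y hY hr
    rw [hYn, h3] at h9
    have h5 : (l0norm (W1 * Ystar * W2) : ℝ) ≤ l0norm (W1 * Y * W2) := by linarith
    exact_mod_cast h5
end

section
/- Let p, q, a, b, n be positive integers with n < min(p, q), let W₁ ∈ ℝ^{a×p} and W₂ ∈ ℝ^{q×b}, and let F ⊆ ℝ^{p×q} be an arbitrary set of matrices. For Y ∈ ℝ^{p×q}, let Y₁₁ denote its top-left n×n submatrix, and let F' = {Y ∈ F : rank(Y₁₁) = n}. Let ν be a real number with ν > min(a, b), and suppose there exists Y ∈ F' with rank(Y) = n. Then a matrix Y* satisfies: Y* ∈ F', rank(Y*) = n, and rank(W₁ Y* W₂) ≤ rank(W₁ Y W₂) for all Y ∈ F' with rank(Y) = n, if and only if Y* ∈ F' and rank(W₁ Y* W₂) + ν·rank(Y*) ≤ rank(W₁ Y W₂) + ν·rank(Y) for all Y ∈ F'. -/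
open Matrix

/-- **Remark after Lemma 2.** With `F' = {Y ∈ F : rank(Y₁₁) = n}` and `ν > min(a,b)`,
assuming `F'` contains a matrix of rank `n`, a matrix `Y*` minimizes `rank(W₁ Y W₂)`
over the rank-`n` matrices of `F'` iff it minimizes `rank(W₁ Y W₂) + ν·rank(Y)` over
`F'`. -/
theorem rank_min_iff_rank_rank_min
    (p q a b n : ℕ) (hp : 0 < p) (hq : 0 < q) (ha : 0 < a) (hb : 0 < b)
    (hn : 0 < n) (hnpq : n < min p q)
    (W1 : Matrix (Fin a) (Fin p) ℝ) (W2 : Matrix (Fin q) (Fin b) ℝ)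
    (F : Set (Matrix (Fin p) (Fin q) ℝ))
    (ν : ℝ) (hν : ((min a b : ℕ) : ℝ) < ν)
    (hfeas : ∃ Y ∈ F,
      (topLeft (le_of_lt (lt_min_iff.mp hnpq).1) (le_of_lt (lt_min_iff.mp hnpq).2) Y).rank = n
        ∧ Y.rank = n)
    (Ystar : Matrix (Fin p) (Fin q) ℝ) :
    (Ystar ∈ F ∧
      (topLeft (le_of_lt (lt_min_iff.mp hnpq).1) (le_of_lt (lt_min_iff.mp hnpq).2) Ystar).rank = n ∧
      Ystar.rank = n ∧
      ∀ Y ∈ F,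
        (topLeft (le_of_lt (lt_min_iff.mp hnpq).1) (le_of_lt (lt_min_iff.mp hnpq).2) Y).rank = n →
        Y.rank = n →
        (W1 * Ystar * W2).rank ≤ (W1 * Y * W2).rank)
    ↔
    (Ystar ∈ F ∧
      (topLeft (le_of_lt (lt_min_iff.mp hnpq).1) (le_of_lt (lt_min_iff.mp hnpq).2) Ystar).rank = n ∧
      ∀ Y ∈ F,
        (topLeft (le_of_lt (lt_min_iff.mp hnpq).1) (le_of_lt (lt_min_iff.mp hnpq).2) Y).rank = n →
        ((W1 * Ystar * W2).rank : ℝ) + ν * (Ystar.rank : ℝ)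
          ≤ ((W1 * Y * W2).rank : ℝ) + ν * (Y.rank : ℝ)) := by
  have key : ∀ Y : Matrix (Fin p) (Fin q) ℝ,
      (topLeft (le_of_lt (lt_min_iff.mp hnpq).1) (le_of_lt (lt_min_iff.mp hnpq).2) Y).rank = n →
      n ≤ Y.rank := fun Y h => h.symm.le.trans (Matrix.rank_submatrix_le Y _ _)
  have bd : ∀ Y : Matrix (Fin p) (Fin q) ℝ, ((W1 * Y * W2).rank : ℝ) < ν := fun Y =>
    lt_of_le_of_lt (Nat.cast_le.mpr
      (le_min (Matrix.rank_le_height _) (Matrix.rank_le_width _))) hν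
  have hν0 : 0 < ν := lt_of_le_of_lt (Nat.cast_nonneg _) hν
  constructor
  · rintro ⟨hF, h1, h2, h3⟩
    refine ⟨hF, h1, fun Y hY hY1 => ?_⟩
    rcases (key Y hY1).eq_or_lt with h | h
    · have h4 : ((W1 * Ystar * W2).rank : ℝ) ≤ ((W1 * Y * W2).rank : ℝ) :=
        Nat.cast_le.mpr (h3 Y hY hY1 h.symm)
      rw [h2, ← h]
      linarith
    · have h4 : (n : ℝ) + 1 ≤ (Y.rank : ℝ) := by exact_mod_cast h
      have h5 := bd Ystar
      have h6 : (0 : ℝ) ≤ ((W1 * Y * W2).rank : ℝ) := Nat.cast_nonneg _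
      have h7 := mul_le_mul_of_nonneg_left h4 hν0.le
      rw [h2]
      linarith
  · rintro ⟨hF, h1, h3⟩
    have h2 : Ystar.rank = n := by
      obtain ⟨Y, hY, hY1, hY2⟩ := hfeas
      by_contra hne
      have h := lt_of_le_of_ne (key Ystar h1) (Ne.symm hne)
      have h4 : (n : ℝ) + 1 ≤ (Ystar.rank : ℝ) := by exact_mod_cast h
      have h5 := bd Y
      have h6 : (0 : ℝ) ≤ ((W1 * Ystar * W2).rank : ℝ) := Nat.cast_nonneg _
      have h7 := mul_le_mul_of_nonneg_left h4 hν0.le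
      have h8 := h3 Y hY hY1
      rw [hY2] at h8
      linarith
    refine ⟨hF, h1, h2, fun Y hY hY1 hY2 => ?_⟩
    have h8 := h3 Y hY hY1
    rw [hY2, h2] at h8
    exact_mod_cast (le_of_add_le_add_right h8)
end
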